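/- arXiv:2408.07447 — 2 statements merged into one kernel-verified Lean document; each statement's English description precedes it below -/
import Mathlib

section
/- Fix n ≥ 1 and 1 ≤ p ≤ n. The set {τ_p^{2l} : 0 ≤ l ≤ ⌊(n−p)/2⌋} is a basis of the space of homogeneous polynomials of degree 2 in ℝ[x_p,…,x_n] that are annihilated by L_{M_p}. In particular this space has dimension ⌊(n−p)/2⌋ + 1. -/
open MvPolynomial

/-- `M_p = Σ_{i=p+1}^{n} (i-p)(n-i+1) x_{i-1} ∂/∂x_i` (1-based indices) as a derivation;
applied to a polynomial `f` it computes `L_{M_p}(f)`. -/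
noncomputable def Mp (n p : ℕ) :
    Derivation ℝ (MvPolynomial (Fin n) ℝ) (MvPolynomial (Fin n) ℝ) :=
  MvPolynomial.mkDerivation ℝ (fun i : Fin n =>
    if p + 1 ≤ (i : ℕ) + 1 then
      C ((((i : ℕ) + 1 : ℝ) - (p : ℝ)) * ((n : ℝ) - ((i : ℕ) + 1 : ℝ) + 1)) *
        X (⟨(i : ℕ) - 1, Nat.lt_of_le_of_lt (Nat.sub_le _ _) i.isLt⟩ : Fin n)
    else 0)

/-- The transvectant polynomial
`τ_p^k = Σ_{j=0}^{k} (-1)^{k-j} C(n-p-(k-j), j) C(n-p-j, k-j) x_{p+k-j} x_{p+j}`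
(1-based variable indices). -/
noncomputable def tau (n p k : ℕ) (hp : 1 ≤ p) (hk : p + k ≤ n) :
    MvPolynomial (Fin n) ℝ :=
  ∑ j : Fin (k + 1),
    C ((-1 : ℝ) ^ (k - (j : ℕ)) *
        ((Nat.choose (n - p - (k - (j : ℕ))) (j : ℕ) : ℝ)) *
        ((Nat.choose (n - p - (j : ℕ)) (k - (j : ℕ)) : ℝ))) *
      (X (⟨p + (k - (j : ℕ)) - 1, by have hj := j.isLt; omega⟩ : Fin n) *
       X (⟨p + (j : ℕ) - 1, by have hj := j.isLt; omega⟩ : Fin n))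

/-- The space of homogeneous polynomials of degree 2 in `ℝ[x_p,…,x_n]` annihilated by
`L_{M_p}`. -/
noncomputable def quadKer (n p : ℕ) : Submodule ℝ (MvPolynomial (Fin n) ℝ) :=
  Subalgebra.toSubmodule (MvPolynomial.supported ℝ {j : Fin n | p ≤ (j : ℕ) + 1}) ⊓
    MvPolynomial.homogeneousSubmodule (Fin n) ℝ 2 ⊓
    LinearMap.ker (Mp n p).toLinearMap

/-- The (0-based) index of the variable `x_{p+a}`, clamped to the last variable. -/
def shiftIdx {n p : ℕ} (hp : 1 ≤ p) (hpn : p ≤ n) (a : ℕ) : Fin n :=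
  ⟨min (p + a - 1) (n - 1), by omega⟩

/-- The second-order Taylor coefficient `∂_i ∂_j f (0)`. -/
noncomputable def hessianZero {n : ℕ} (i j : Fin n) : MvPolynomial (Fin n) ℝ →ₗ[ℝ] ℝ :=
  lcoeff ℝ 0 ∘ₗ (pderiv i).toLinearMap ∘ₗ (pderiv j).toLinearMap

lemma hessianZero_apply {n : ℕ} (i j : Fin n) (f : MvPolynomial (Fin n) ℝ) :
    hessianZero i j f = coeff 0 (pderiv i (pderiv j f)) := rfl

lemma pderiv_pderiv_X {n : ℕ} (i j k : Fin n) :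
    pderiv i (pderiv j (X k : MvPolynomial (Fin n) ℝ)) = 0 := by
  rw [pderiv_X, Pi.single_apply]
  split_ifs <;> simp

lemma pderiv_comm {n : ℕ} (i j : Fin n) (f : MvPolynomial (Fin n) ℝ) :
    pderiv i (pderiv j f) = pderiv j (pderiv i f) := by
  have h : ⁅(pderiv i : Derivation ℝ (MvPolynomial (Fin n) ℝ) (MvPolynomial (Fin n) ℝ)),
      (pderiv j : Derivation ℝ (MvPolynomial (Fin n) ℝ) (MvPolynomial (Fin n) ℝ))⁆ = 0 := by
    apply derivation_ext
    intro k
    rw [Derivation.commutator_apply, pderiv_pderiv_X, pderiv_pderiv_X, sub_zero,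
      Derivation.zero_apply]
  have h' := congrArg (fun D => D f) h
  simpa [Derivation.commutator_apply, sub_eq_zero] using h'

lemma hessianZero_comm {n : ℕ} (i j : Fin n) (f : MvPolynomial (Fin n) ℝ) :
    hessianZero i j f = hessianZero j i f := by
  rw [hessianZero_apply, hessianZero_apply, pderiv_comm]

lemma constantCoeff_pderiv_X {n : ℕ} (i k : Fin n) :
    constantCoeff (pderiv i (X k : MvPolynomial (Fin n) ℝ)) = if i = k then 1 else 0 := by
  rw [pderiv_X, Pi.single_apply]
  split_ifs with h1 h2 h2
  · simp
  · exact absurd h1.symm h2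
  · exact absurd h2.symm h1
  · simp

lemma hessianZero_X_mul_X {n : ℕ} (i j k l : Fin n) :
    hessianZero i j (X k * X l) =
      (if j = k ∧ i = l then 1 else 0) + (if j = l ∧ i = k then 1 else 0) := by
  rw [hessianZero_apply, ← constantCoeff_eq]
  simp only [pderiv_mul, map_add, pderiv_pderiv_X, map_mul, constantCoeff_pderiv_X, zero_mul,
    mul_zero, zero_add, add_zero]
  simp only [ite_and, mul_ite, mul_one, mul_zero]
  split_ifs <;> simp

lemma exists_eq_add_single {σ : Type*} {d : σ →₀ ℕ} {k : ℕ} (h : d.degree = k + 1) :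
    ∃ (i : σ) (e : σ →₀ ℕ), d = e + Finsupp.single i 1 ∧ e.degree = k := by
  have hd : d ≠ 0 := by rintro rfl; simp at h
  obtain ⟨i, hi⟩ := Finsupp.ne_iff.mp hd
  have hle : Finsupp.single i 1 ≤ d := by
    rw [Finsupp.single_le_iff]
    exact Nat.one_le_iff_ne_zero.mpr hi
  refine ⟨i, d - Finsupp.single i 1, (tsub_add_cancel_of_le hle).symm, ?_⟩
  have := congrArg Finsupp.degree (tsub_add_cancel_of_le hle)
  rw [map_add, Finsupp.degree_single, h] at this
  omega

/-- A quadratic form is determined by its Hessian. -/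
lemma eq_zero_of_hessianZero {n : ℕ} {f : MvPolynomial (Fin n) ℝ} (hf : f.IsHomogeneous 2)
    (h : ∀ i j, hessianZero i j f = 0) : f = 0 := by
  ext d
  rw [coeff_zero]
  by_cases hd : d.degree = 2
  · obtain ⟨j, e, rfl, he⟩ := exists_eq_add_single hd
    obtain ⟨i, e', rfl, he'⟩ := exists_eq_add_single he
    obtain rfl := (Finsupp.degree_eq_zero_iff e').mp he'
    have := h i j
    rw [hessianZero_apply, coeff_pderiv, coeff_pderiv] at this
    have h0 : ∀ m : ℕ, (m : ℝ) + 1 ≠ 0 := fun m => by positivity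
    simpa [h0] using this
  · exact hf.coeff_eq_zero hd

section Shift

variable {n p : ℕ} (hp : 1 ≤ p) (hpn : p ≤ n)

lemma shiftIdx_val {a : ℕ} (ha : a ≤ n - p) : (shiftIdx hp hpn a : ℕ) = p + a - 1 := by
  simp only [shiftIdx]
  omega

lemma shiftIdx_inj {a b : ℕ} (ha : a ≤ n - p) (hb : b ≤ n - p) :
    shiftIdx hp hpn a = shiftIdx hp hpn b ↔ a = b := by
  rw [Fin.ext_iff, shiftIdx_val hp hpn ha, shiftIdx_val hp hpn hb]
  omega

lemma exists_shiftIdx {i : Fin n} (hi : p ≤ (i : ℕ) + 1) :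
    ∃ a ≤ n - p, i = shiftIdx hp hpn a := by
  refine ⟨i + 1 - p, by omega, ?_⟩
  rw [Fin.ext_iff, shiftIdx_val hp hpn (by omega)]
  omega

lemma Mp_X_shiftIdx {a : ℕ} (ha : a ≤ n - p) :
    Mp n p (X (shiftIdx hp hpn a)) =
      C ((a : ℝ) * ((n - p : ℕ) - a + 1)) * X (shiftIdx hp hpn (a - 1)) := by
  have hv := shiftIdx_val hp hpn ha
  rw [Mp, mkDerivation_X]
  rcases Nat.eq_zero_or_pos a with rfl | h0
  · rw [if_neg (by omega)]
    simp
  · rw [if_pos (by omega)]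
    have hc : ((shiftIdx hp hpn a : ℕ) : ℝ) + 1 = p + a := by
      rw [hv]
      exact_mod_cast (by omega : p + a - 1 + 1 = p + a)
    congr 2
    · rw [hc, Nat.cast_sub hpn]
      ring
    · simp only [Fin.ext_iff, shiftIdx_val hp hpn (show a - 1 ≤ n - p by omega), hv]
      omega

lemma Mp_X_of_lt {i : Fin n} (hi : (i : ℕ) + 1 < p) : Mp n p (X i) = 0 := by
  rw [Mp, mkDerivation_X, if_neg (by omega)]

lemma coeff_zero_Mp (f : MvPolynomial (Fin n) ℝ) : coeff 0 (Mp n p f) = 0 := by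
  induction f using MvPolynomial.induction_on with
  | C a => simp
  | add f g hf hg => rw [map_add, coeff_add, hf, hg, add_zero]
  | mul_X f i hf =>
    have hX : constantCoeff (Mp n p (X i)) = 0 := by
      rw [Mp, mkDerivation_X]
      split_ifs <;> simp
    rw [← constantCoeff_eq] at hf ⊢
    simp [Derivation.leibniz, hf, hX]

/-- The commutation relation of `L_{M_p}` with the partial derivatives. -/
lemma pderiv_Mp {a : ℕ} (ha : a ≤ n - p) (f : MvPolynomial (Fin n) ℝ) :
    pderiv (shiftIdx hp hpn a) (Mp n p f) = Mp n p (pderiv (shiftIdx hp hpn a) f) +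
      (((a : ℝ) + 1) * ((n - p : ℕ) - a)) • pderiv (shiftIdx hp hpn (a + 1)) f := by
  have h : ⁅(pderiv (shiftIdx hp hpn a) :
        Derivation ℝ (MvPolynomial (Fin n) ℝ) (MvPolynomial (Fin n) ℝ)), Mp n p⁆ =
      (((a : ℝ) + 1) * ((n - p : ℕ) - a)) • pderiv (shiftIdx hp hpn (a + 1)) := by
    apply derivation_ext
    intro i
    rw [Derivation.commutator_apply, Derivation.smul_apply, pderiv_X, pderiv_X]
    have h0 : Mp n p (Pi.single (M := fun _ => MvPolynomial (Fin n) ℝ)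
        (shiftIdx hp hpn a) 1 i) = 0 := by
      rw [Pi.single_apply]
      split_ifs <;> simp
    rw [h0, sub_zero]
    rcases lt_or_ge ((i : ℕ) + 1) p with hi | hi
    · have hne : i ≠ shiftIdx hp hpn (a + 1) := by
        rw [Ne, Fin.ext_iff]
        simp only [shiftIdx]
        omega
      rw [Mp_X_of_lt hi, Pi.single_eq_of_ne hne]
      simp
    · obtain ⟨b, hb, rfl⟩ := exists_shiftIdx hp hpn hi
      rw [Mp_X_shiftIdx hp hpn hb, pderiv_C_mul, pderiv_X, Pi.single_apply, Pi.single_apply]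
      simp only [shiftIdx_inj hp hpn (show b - 1 ≤ n - p by omega) ha]
      rcases ha.eq_or_lt with rfl | ha'
      · rcases Nat.eq_zero_or_pos b with rfl | h0
        · simp
        · rw [if_neg (by omega)]
          simp
      · simp only [shiftIdx_inj hp hpn hb (Nat.succ_le_of_lt ha')]
        rcases Nat.eq_zero_or_pos b with rfl | h0
        · simp
        · obtain ⟨c, rfl⟩ := Nat.exists_eq_succ_of_ne_zero h0.ne'
          by_cases hc : c = a
          · subst hc
            have hcoeff : ((c.succ : ℕ) : ℝ) * ((n - p : ℕ) - (c.succ : ℕ) + 1) =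
                ((c : ℝ) + 1) * ((n - p : ℕ) - c) := by
              push_cast
              ring
            rw [hcoeff, smul_eq_C_mul]
            simp
          · simp [hc]
  have h' := congrArg (fun D => D f) h
  simp only [Derivation.commutator_apply, Derivation.smul_apply] at h'
  rw [← h']
  abel

lemma hessianZero_recurrence {f : MvPolynomial (Fin n) ℝ} (hf : Mp n p f = 0) {a b : ℕ}
    (ha : a ≤ n - p) (hb : b ≤ n - p) :
    ((a : ℝ) + 1) * ((n - p : ℕ) - a) *
        hessianZero (shiftIdx hp hpn (a + 1)) (shiftIdx hp hpn b) f +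
      ((b : ℝ) + 1) * ((n - p : ℕ) - b) *
        hessianZero (shiftIdx hp hpn a) (shiftIdx hp hpn (b + 1)) f = 0 := by
  have h := congrArg (fun g => coeff 0 (pderiv (shiftIdx hp hpn a)
    (pderiv (shiftIdx hp hpn b) g))) hf
  simp only [pderiv_Mp hp hpn ha, pderiv_Mp hp hpn hb, map_add, map_zero, coeff_add, coeff_smul,
    coeff_zero_Mp, Derivation.map_smul, coeff_zero, smul_eq_mul, zero_add] at h
  simpa only [hessianZero_apply] using h

end Shift

/-- A symmetric array satisfying the kernel recurrence vanishes as soon as the even entries of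
its first row do. -/
lemma eq_zero_of_recurrence {m : ℕ} {G : ℕ → ℕ → ℝ} (hsymm : ∀ a b, G a b = G b a)
    (hrec : ∀ a ≤ m, ∀ b ≤ m,
      ((a : ℝ) + 1) * ((m : ℝ) - a) * G (a + 1) b + ((b : ℝ) + 1) * ((m : ℝ) - b) * G a (b + 1) = 0)
    (heven : ∀ b ≤ m, Even b → G 0 b = 0) {a b : ℕ} (ha : a ≤ m) (hb : b ≤ m) : G a b = 0 := by
  let w : ℕ → ℝ := fun a => ∏ i ∈ Finset.range a, ((i : ℝ) + 1) * ((m : ℝ) - i)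
  have hw : ∀ a, w (a + 1) = w a * (((a : ℝ) + 1) * ((m : ℝ) - a)) :=
    fun a => Finset.prod_range_succ _ _
  have hw0 : ∀ a, m < a → w a = 0 := fun a h =>
    Finset.prod_eq_zero (Finset.mem_range.mpr h) (by simp)
  have hw1 : ∀ a ≤ m, w a ≠ 0 := fun a h => by
    refine Finset.prod_ne_zero_iff.mpr fun i hi => mul_ne_zero (by positivity) ?_
    have : (i : ℝ) < m := by exact_mod_cast (Finset.mem_range.mp hi).trans_le h
    exact (sub_pos.mpr this).ne'
  let H : ℕ → ℕ → ℝ := fun a b => w a * w b * G a b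
  have hH : ∀ a b, H (a + 1) b = -H a (b + 1) := by
    intro a b
    simp only [H]
    rcases lt_or_ge m a with h | ha
    · simp [hw0 a h, hw0 (a + 1) (by omega)]
    rcases lt_or_ge m b with h | hb
    · simp [hw0 b h, hw0 (b + 1) (by omega)]
    rw [hw, hw]
    linear_combination w a * w b * hrec a ha b hb
  have hrow : ∀ a b, H a b = (-1) ^ a * H 0 (a + b) := by
    intro a
    induction a with
    | zero => simp
    | succ a ih =>
      intro b
      rw [hH, ih, pow_succ, show a + (b + 1) = a + 1 + b by ring]
      ring
  have hzero : ∀ s, H 0 s = 0 := by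
    intro s
    rcases lt_or_ge m s with h | hs
    · simp [H, hw0 s h]
    rcases Nat.even_or_odd s with h | h
    · simp [H, heven s hs h]
    · have h1 := hrow s 0
      have h2 : H s 0 = H 0 s := by simp only [H]; rw [hsymm s 0]; ring
      rw [h.neg_one_pow, add_zero, h2] at h1
      linarith
  have h := hrow a b
  rw [hzero, mul_zero] at h
  simpa [H, hw1 a ha, hw1 b hb] using h

/-- The coefficients of the transvectants, with `m = n - p`. -/
noncomputable def tauCoeff (m a b : ℕ) : ℝ :=
  (-1) ^ a * ((m - a).choose b : ℝ) * ((m - b).choose a : ℝ)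

lemma tauCoeff_recurrence {m a b : ℕ} (h : a + b < m) :
    tauCoeff m (a + 1) b * (((a : ℝ) + 1) * ((m : ℝ) - a)) +
      tauCoeff m a (b + 1) * (((b : ℝ) + 1) * ((m : ℝ) - b)) = 0 := by
  obtain ⟨r, rfl⟩ : ∃ r, m = a + b + 1 + r := ⟨m - (a + b + 1), by omega⟩
  simp only [tauCoeff, show a + b + 1 + r - (a + 1) = b + r by omega,
    show a + b + 1 + r - b = a + r + 1 by omega, show a + b + 1 + r - a = b + r + 1 by omega,
    show a + b + 1 + r - (b + 1) = a + r by omega]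
  have h1 : ((a + r : ℕ) + 1 : ℝ) * ((a + r).choose a : ℝ) =
      ((a + r + 1).choose (a + 1) : ℝ) * (a + 1) := by
    exact_mod_cast Nat.add_one_mul_choose_eq (a + r) a
  have h2 : ((b + r : ℕ) + 1 : ℝ) * ((b + r).choose b : ℝ) =
      ((b + r + 1).choose (b + 1) : ℝ) * (b + 1) := by
    exact_mod_cast Nat.add_one_mul_choose_eq (b + r) b
  push_cast at h1 h2 ⊢
  rw [pow_succ]
  linear_combination (-1 : ℝ) ^ a * ((b + r).choose b : ℝ) * (b + r + 1) * h1 -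
    (-1 : ℝ) ^ a * ((a + r).choose a : ℝ) * (a + r + 1) * h2

section Tau

variable {n p : ℕ} (hp : 1 ≤ p) (hpn : p ≤ n)

lemma tau_eq_sum {k : ℕ} (hk : p + k ≤ n) :
    tau n p k hp hk = ∑ j ∈ Finset.range (k + 1), tauCoeff (n - p) (k - j) j •
      (X (shiftIdx hp hpn (k - j)) * X (shiftIdx hp hpn j) : MvPolynomial (Fin n) ℝ) := by
  rw [Finset.sum_range, tau]
  refine Finset.sum_congr rfl fun j _ => ?_
  have hj := j.isLt
  rw [smul_eq_C_mul, tauCoeff]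
  congr 3 <;> rw [Fin.ext_iff, shiftIdx_val hp hpn (by omega)]

lemma Mp_tau {k : ℕ} (hk : p + k ≤ n) : Mp n p (tau n p k hp hk) = 0 := by
  have hpn : p ≤ n := by omega
  have hterm : ∀ j ∈ Finset.range (k + 1),
      Mp n p (tauCoeff (n - p) (k - j) j • (X (shiftIdx hp hpn (k - j)) * X (shiftIdx hp hpn j))) =
      (tauCoeff (n - p) (k - j) j * (((k - j : ℕ) : ℝ) * ((n - p : ℕ) - (k - j : ℕ) + 1))) •
          (X (shiftIdx hp hpn (k - j - 1)) * X (shiftIdx hp hpn j)) +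
        (tauCoeff (n - p) (k - j) j * ((j : ℝ) * ((n - p : ℕ) - j + 1))) •
          (X (shiftIdx hp hpn (k - j)) * X (shiftIdx hp hpn (j - 1))) := by
    intro j hj
    rw [Finset.mem_range] at hj
    rw [Derivation.map_smul, Derivation.leibniz, Mp_X_shiftIdx hp hpn (by omega),
      Mp_X_shiftIdx hp hpn (by omega)]
    simp only [smul_eq_C_mul, smul_eq_mul, C_mul]
    ring
  rw [tau_eq_sum hp hpn hk, map_sum, Finset.sum_congr rfl hterm, Finset.sum_add_distrib,
    Finset.sum_range_succ, Finset.sum_range_succ' (n := k)]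
  simp only [Nat.sub_self, CharP.cast_eq_zero, zero_mul, mul_zero, zero_smul, add_zero]
  rw [← Finset.sum_add_distrib]
  refine Finset.sum_eq_zero fun j hj => ?_
  rw [Finset.mem_range] at hj
  obtain ⟨a, rfl⟩ : ∃ a, k = a + j + 1 := ⟨k - j - 1, by omega⟩
  have h := tauCoeff_recurrence (m := n - p) (a := a) (b := j) (by omega)
  simp only [show a + j + 1 - j = a + 1 by omega, show a + j + 1 - (j + 1) = a by omega,
    Nat.add_sub_cancel]
  rw [← add_smul]
  convert zero_smul ℝ _
  push_cast
  linear_combination h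

lemma tau_mem_quadKer {k : ℕ} (hk : p + k ≤ n) : tau n p k hp hk ∈ quadKer n p := by
  have hpn : p ≤ n := by omega
  refine ⟨⟨?_, ?_⟩, Mp_tau hp hk⟩ <;> rw [tau_eq_sum hp hpn hk]
  · refine Submodule.sum_mem _ fun j hj => Submodule.smul_mem _ _ ?_
    rw [Finset.mem_range] at hj
    refine Subalgebra.mul_mem _ ?_ ?_ <;> rw [X_mem_supported, Set.mem_ofPred_eq,
      shiftIdx_val hp hpn (by omega)] <;> omega
  · exact Submodule.sum_mem _ fun j _ => Submodule.smul_mem _ _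
      ((isHomogeneous_X ℝ _).mul (isHomogeneous_X ℝ _))

/-- The first row of the Hessian of `τ_p^k`. -/
lemma hessianZero_tau {k b : ℕ} (hk : p + k ≤ n) (hb : b ≤ n - p) (hk2 : Even k) :
    hessianZero (shiftIdx hp hpn 0) (shiftIdx hp hpn b) (tau n p k hp hk) =
      if b = k then 2 * ((n - p).choose k : ℝ) else 0 := by
  have hterm : ∀ j ∈ Finset.range (k + 1),
      hessianZero (shiftIdx hp hpn 0) (shiftIdx hp hpn b) (tauCoeff (n - p) (k - j) j •
        (X (shiftIdx hp hpn (k - j)) * X (shiftIdx hp hpn j) : MvPolynomial (Fin n) ℝ)) =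
      (if j = 0 then (if b = k then ((n - p).choose k : ℝ) else 0) else 0) +
        (if j = k then (if b = k then ((n - p).choose k : ℝ) else 0) else 0) := by
    intro j hj
    rw [Finset.mem_range] at hj
    simp only [map_smul, hessianZero_X_mul_X, smul_eq_mul, mul_add, shiftIdx_inj hp hpn hb
      (show j ≤ n - p by omega), shiftIdx_inj hp hpn hb (show k - j ≤ n - p by omega),
      shiftIdx_inj hp hpn (Nat.zero_le _) (show j ≤ n - p by omega),
      shiftIdx_inj hp hpn (Nat.zero_le _) (show k - j ≤ n - p by omega)]
    congr 1
    · by_cases h : j = 0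
      · subst h
        simp [tauCoeff, hk2.neg_one_pow]
      · simp [h, Ne.symm h]
    · by_cases h : j = k
      · subst h
        simp [tauCoeff]
      · have : ¬ (0 = k - j) := by omega
        simp [h, this]
  rw [tau_eq_sum hp hpn hk, map_sum, Finset.sum_congr rfl hterm, Finset.sum_add_distrib]
  rw [Finset.sum_ite_eq', Finset.sum_ite_eq', if_pos (Finset.mem_range.mpr k.succ_pos),
    if_pos (Finset.mem_range.mpr k.lt_succ_self)]
  split_ifs <;> ring

lemma eq_zero_of_mem_quadKer {f : MvPolynomial (Fin n) ℝ} (hf : f ∈ quadKer n p)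
    (h : ∀ b ≤ n - p, Even b → hessianZero (shiftIdx hp hpn 0) (shiftIdx hp hpn b) f = 0) :
    f = 0 := by
  obtain ⟨⟨hsupp, hhom⟩, hker⟩ := hf
  have hvars : ∀ j : Fin n, ¬ p ≤ (j : ℕ) + 1 → pderiv j f = 0 := fun j hj =>
    pderiv_eq_zero_of_notMem_vars fun hm => hj (mem_supported.mp hsupp hm)
  refine eq_zero_of_hessianZero hhom fun i j => ?_
  by_cases hj : p ≤ (j : ℕ) + 1
  · by_cases hi : p ≤ (i : ℕ) + 1
    · obtain ⟨a, ha, rfl⟩ := exists_shiftIdx hp hpn hi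
      obtain ⟨b, hb, rfl⟩ := exists_shiftIdx hp hpn hj
      exact eq_zero_of_recurrence
        (G := fun a b => hessianZero (shiftIdx hp hpn a) (shiftIdx hp hpn b) f)
        (fun _ _ => hessianZero_comm _ _ _)
        (fun a ha b hb => hessianZero_recurrence hp hpn hker ha hb) h ha hb
    · rw [hessianZero_comm, hessianZero_apply, hvars i hi]
      simp
  · rw [hessianZero_apply, hvars j hj]
    simp

end Tau

/-- `{τ_p^{2l} : 0 ≤ l ≤ ⌊(n-p)/2⌋}` is a basis of the space of homogeneous
degree-2 polynomials in `ℝ[x_p,…,x_n]` annihilated by `L_{M_p}`; in particular that space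
has dimension `⌊(n-p)/2⌋ + 1`. -/
theorem tau_basis_quadKer (n p : ℕ) (hn : 1 ≤ n) (hp : 1 ≤ p) (hpn : p ≤ n) :
    LinearIndependent ℝ (fun l : Fin ((n - p) / 2 + 1) =>
      tau n p (2 * (l : ℕ)) hp (by have hl := l.isLt; omega)) ∧
    Submodule.span ℝ (Set.range (fun l : Fin ((n - p) / 2 + 1) =>
      tau n p (2 * (l : ℕ)) hp (by have hl := l.isLt; omega))) = quadKer n p ∧
    Module.finrank ℝ (quadKer n p) = (n - p) / 2 + 1 := by
  set v : Fin ((n - p) / 2 + 1) → MvPolynomial (Fin n) ℝ := fun l =>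
    tau n p (2 * (l : ℕ)) hp (by have hl := l.isLt; omega) with hv
  let φ : Fin ((n - p) / 2 + 1) → MvPolynomial (Fin n) ℝ →ₗ[ℝ] ℝ := fun l =>
    hessianZero (shiftIdx hp hpn 0) (shiftIdx hp hpn (2 * (l : ℕ)))
  let c : Fin ((n - p) / 2 + 1) → ℝ := fun l => 2 * ((n - p).choose (2 * (l : ℕ)) : ℝ)
  have hφ : ∀ l l', φ l (v l') = if l = l' then c l' else 0 := by
    intro l l'
    have hl := l.isLt
    rw [hessianZero_tau hp hpn _ (by omega) (even_two_mul _)]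
    simp only [c, Fin.ext_iff, mul_right_inj' (two_ne_zero' ℕ)]
  have hc : ∀ l, c l ≠ 0 := by
    intro l
    have hl := l.isLt
    have : 0 < (n - p).choose (2 * (l : ℕ)) := Nat.choose_pos (by omega)
    positivity
  have hφsum : ∀ (g : Fin ((n - p) / 2 + 1) → ℝ) l, φ l (∑ l', g l' • v l') = g l * c l := by
    intro g l
    simp [map_sum, hφ]
  have hli : LinearIndependent ℝ v := by
    rw [Fintype.linearIndependent_iff]
    intro g hg l
    have h := hφsum g l
    rw [hg, map_zero] at h
    exact (mul_eq_zero.mp h.symm).resolve_right (hc l)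
  have hmem : ∀ l, v l ∈ quadKer n p := fun l => tau_mem_quadKer hp _
  have hspan : Submodule.span ℝ (Set.range v) = quadKer n p := by
    refine le_antisymm (Submodule.span_le.mpr (Set.range_subset_iff.mpr hmem)) fun f hf => ?_
    have hzero : f - ∑ l, (φ l f / c l) • v l = 0 := by
      refine eq_zero_of_mem_quadKer hp hpn (Submodule.sub_mem _ hf
        (Submodule.sum_mem _ fun l _ => Submodule.smul_mem _ _ (hmem l))) fun b hb hb2 => ?_
      obtain ⟨l, rfl⟩ := hb2.two_dvd
      change φ ⟨l, by omega⟩ _ = 0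
      rw [map_sub, hφsum, div_mul_cancel₀ _ (hc _), sub_self]
    rw [sub_eq_zero.mp hzero]
    exact Submodule.sum_mem _ fun l _ => Submodule.smul_mem _ _
      (Submodule.subset_span (Set.mem_range_self l))
  refine ⟨hli, hspan, ?_⟩
  rw [← hspan, finrank_span_eq_card hli, Fintype.card_fin]
end

section
/- In ℝ[x_1,x_2,x_3] let Δ = 2x_1x_3 − x_2² and N = x_2 ∂/∂x_1 + x_3 ∂/∂x_2. For every integer l ≥ 0, every integer m ≥ 1, and every a ∈ ℝ, set c = −2a·x_2·x_1^{l+1}·Δ^{m−1} ∂/∂x_1 and o = −(2l+3)·a·x_2·x_1^{l}·Δ^{m−1}. Then [c, N] + o·x_2 ∂/∂x_1 = a·x_1^{l}·Δ^{m} ∂/∂x_1. Consequently every term of the form x_1^l Δ^m ∂/∂x_1 with m > 0 lies in the image of the outer transformation operator ρ and can be eliminated from the first component of the 3D feed forward system. -/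
open MvPolynomial

/-- `Δ = 2x₁x₃ − x₂²` in `ℝ[x₁,x₂,x₃]` (variables `x₁ = X 0`, `x₂ = X 1`, `x₃ = X 2`). -/
noncomputable def Δp : MvPolynomial (Fin 3) ℝ :=
  2 * X (0 : Fin 3) * X (2 : Fin 3) - X (1 : Fin 3) ^ 2

/-- A vector field `f ∂/∂x₁` as a derivation of `ℝ[x₁,x₂,x₃]`. -/
noncomputable def vf3 (f : MvPolynomial (Fin 3) ℝ) :
    Derivation ℝ (MvPolynomial (Fin 3) ℝ) (MvPolynomial (Fin 3) ℝ) :=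
  MvPolynomial.mkDerivation ℝ (fun v : Fin 3 => if v = 0 then f else 0)

/-- `N = x₂ ∂/∂x₁ + x₃ ∂/∂x₂` as a derivation of `ℝ[x₁,x₂,x₃]`. -/
noncomputable def N3 :
    Derivation ℝ (MvPolynomial (Fin 3) ℝ) (MvPolynomial (Fin 3) ℝ) :=
  MvPolynomial.mkDerivation ℝ (fun v : Fin 3 =>
    if v = 0 then X (1 : Fin 3) else if v = 1 then X (2 : Fin 3) else 0)

@[simp]
theorem vf3_X (f : MvPolynomial (Fin 3) ℝ) (i : Fin 3) :
    vf3 f (X i) = if i = 0 then f else 0 :=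
  mkDerivation_X _ _ _

theorem N3_X (i : Fin 3) :
    N3 (X i) = if i = 0 then X (1 : Fin 3) else if i = 1 then X (2 : Fin 3) else 0 :=
  mkDerivation_X _ _ _

@[simp]
theorem N3_X_zero : N3 (X 0) = X 1 := by simp [N3_X]

@[simp]
theorem N3_X_one : N3 (X 1) = X 2 := by simp [N3_X]

@[simp]
theorem N3_X_two : N3 (X 2) = 0 := by simp [N3_X]

/-- `Δ` is an invariant of the flow of `N`. -/
@[simp]
theorem N3_Δp : N3 Δp = 0 := by
  have h : Δp = X 0 * X 2 + X 0 * X 2 - X 1 * X 1 := by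
    rw [Δp]
    ring
  rw [h]
  simp only [map_sub, map_add, Derivation.leibniz, N3_X_zero, N3_X_one, N3_X_two, smul_eq_mul]
  ring

/-- `[f ∂/∂x₁, N] = -N(f) ∂/∂x₁`: the components of `N` do not involve `x₁`. -/
theorem vf3_lie_N3 (f : MvPolynomial (Fin 3) ℝ) : ⁅vf3 f, N3⁆ = vf3 (-N3 f) := by
  refine MvPolynomial.derivation_ext fun i => ?_
  fin_cases i <;> simp [Derivation.commutator_apply]

theorem vf3_add (f g : MvPolynomial (Fin 3) ℝ) : vf3 (f + g) = vf3 f + vf3 g := by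
  refine MvPolynomial.derivation_ext fun i => ?_
  fin_cases i <;> simp

/-- for `l ≥ 0`, `m ≥ 1`, `a ∈ ℝ`, with
`c = −2a·x₂·x₁^{l+1}·Δ^{m−1} ∂/∂x₁` and `o = −(2l+3)·a·x₂·x₁^l·Δ^{m−1}`, one has
`[c, N] + o·x₂ ∂/∂x₁ = a·x₁^l·Δ^m ∂/∂x₁`. -/
theorem outer_elimination_Delta_terms_3d (l m : ℕ) (hm : 1 ≤ m) (a : ℝ) :
    ⁅vf3 (C (-2 * a) * X (1 : Fin 3) * X (0 : Fin 3) ^ (l + 1) * Δp ^ (m - 1)), N3⁆ +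
      vf3 ((C (-(2 * (l : ℝ) + 3) * a) * X (1 : Fin 3) * X (0 : Fin 3) ^ l * Δp ^ (m - 1)) *
        X (1 : Fin 3)) =
      vf3 (C a * X (0 : Fin 3) ^ l * Δp ^ m) := by
  obtain ⟨k, rfl⟩ := Nat.exists_eq_add_of_le' hm
  rw [vf3_lie_N3, ← vf3_add]
  congr 1
  simp only [Derivation.leibniz, Derivation.leibniz_pow, derivation_C, N3_X_zero, N3_X_one, N3_Δp,
    smul_eq_mul, nsmul_eq_mul, Nat.add_sub_cancel, pow_succ Δp k, smul_zero, mul_zero]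
  simp only [map_mul, map_neg, map_add, map_natCast, map_ofNat, Nat.cast_add, Nat.cast_one]
  rw [Δp]
  ring
end
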